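/- Let d ≥ 1, let Σ ⊆ ℝ^d be uniformly discrete with separation r_Σ > 0, let (μ_i)_{i∈Σ}, ℙ, p_i(ε) be as in the product-measure setup, and fix ε > 0 and a > 1. For n ∈ ℕ let a_n := ℙ*{ω ∈ Ω : no annulus A_{r,r+n} with r ∈ [a^n, a^{n+1} − n] is ε-free for ω}, where ℙ* denotes outer measure. If ‖i‖^{d−1}·p_i(ε) → 0 as ‖i‖ → ∞ along i ∈ Σ, then ∑_{n=1}^∞ a_n < ∞. -/

import Mathlib

open MeasureTheory Set

/-- The closed annulus `{x : r ≤ ‖x‖ ≤ R}` in `ℝ^d`. -/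
def annulus (d : ℕ) (r R : ℝ) : Set (EuclideanSpace ℝ (Fin d)) :=
  {x | r ≤ ‖x‖ ∧ ‖x‖ ≤ R}

/-- A set `U ⊆ ℝ^d` is `ε`-free for `ω` if `ω i ≤ ε` for all `i ∈ Σ ∩ U`. -/
def epsFree {d : ℕ} (S : Set (EuclideanSpace ℝ (Fin d))) (ε : ℝ)
    (ω : S → ℝ) (U : Set (EuclideanSpace ℝ (Fin d))) : Prop :=
  ∀ i : S, (i : EuclideanSpace ℝ (Fin d)) ∈ U → ω i ≤ ε


lemma aux_indep {S : Type*} (μ : S → Measure ℝ) (P : Measure (S → ℝ)) [IsProbabilityMeasure P]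
    (hprod : ∀ (t : Finset S) (s : S → Set ℝ), (∀ i, MeasurableSet (s i)) →
      P {ω | ∀ i ∈ t, ω i ∈ s i} = ∏ i ∈ t, μ i (s i)) (ε : ℝ) (T : ℕ → Finset S)
    (hT : ∀ k l, k ≠ l → Disjoint (T k) (T l)) (F : Finset ℕ) :
    ∀ t : Finset S, (∀ k ∈ F, Disjoint t (T k)) →
      P.real {ω | (∀ i ∈ t, ω i ≤ ε) ∧ ∀ k ∈ F, ¬ ∀ i ∈ T k, ω i ≤ ε}
        = (∏ i ∈ t, (μ i).real (Iic ε)) * ∏ k ∈ F, (1 - ∏ i ∈ T k, (μ i).real (Iic ε)) := by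
  classical
  have hmeas : ∀ t : Finset S, MeasurableSet {ω : S → ℝ | ∀ i ∈ t, ω i ≤ ε} := by
    intro t
    have : {ω : S → ℝ | ∀ i ∈ t, ω i ≤ ε} = ⋂ i ∈ t, {ω : S → ℝ | ω i ≤ ε} := by
      ext ω; simp
    rw [this]
    exact Finset.measurableSet_biInter t
      (fun i _ => measurableSet_le (measurable_pi_apply i) measurable_const)
  induction F using Finset.induction_on with
  | empty =>
    intro t _
    have h := hprod t (fun _ => Iic ε) (fun _ => measurableSet_Iic)
    simp only [mem_Iic] at h
    simp [Measure.real, h, ENNReal.toReal_prod]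
  | insert k F hk ih =>
    intro t ht
    have h1 := ih t (fun l hl => ht l (Finset.mem_insert_of_mem hl))
    have hdk : Disjoint t (T k) := ht k (Finset.mem_insert_self _ _)
    have h2 := ih (t ∪ T k) (fun l hl => by
      rw [Finset.disjoint_union_left]
      exact ⟨ht l (Finset.mem_insert_of_mem hl), hT k l (by rintro rfl; exact hk hl)⟩)
    have hs : {ω : S → ℝ | (∀ i ∈ t, ω i ≤ ε) ∧ ∀ l ∈ insert k F, ¬ ∀ i ∈ T l, ω i ≤ ε}
        = {ω | (∀ i ∈ t, ω i ≤ ε) ∧ ∀ k ∈ F, ¬ ∀ i ∈ T k, ω i ≤ ε} \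
          {ω : S → ℝ | ∀ i ∈ T k, ω i ≤ ε} := by
      ext ω
      simp only [Finset.forall_mem_insert, mem_sdiff, mem_ofPred_eq]
      tauto
    have hi : {ω : S → ℝ | (∀ i ∈ t ∪ T k, ω i ≤ ε) ∧ ∀ k ∈ F, ¬ ∀ i ∈ T k, ω i ≤ ε}
        = {ω | (∀ i ∈ t, ω i ≤ ε) ∧ ∀ k ∈ F, ¬ ∀ i ∈ T k, ω i ≤ ε} ∩
          {ω : S → ℝ | ∀ i ∈ T k, ω i ≤ ε} := by
      ext ω
      simp only [Finset.forall_mem_union, mem_inter_iff, mem_ofPred_eq]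
      tauto
    have h3 := measureReal_inter_add_sdiff (μ := P)
      (s := {ω | (∀ i ∈ t, ω i ≤ ε) ∧ ∀ k ∈ F, ¬ ∀ i ∈ T k, ω i ≤ ε}) (hmeas (T k))
    rw [← hi, ← hs, h1, h2, Finset.prod_union hdk] at h3
    rw [Finset.prod_insert hk]
    linear_combination h3

lemma aux_count {d : ℕ} (hd : 1 ≤ d) (t : Finset (EuclideanSpace ℝ (Fin d))) (ρ r R : ℝ)
    (hρ : 0 < ρ) (hr : ρ ≤ r) (hrR : r ≤ R)
    (hdisc : ∀ i ∈ t, ∀ j ∈ t, i ≠ j → 2 * ρ ≤ ‖i - j‖)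
    (ht : ∀ i ∈ t, i ∈ annulus d r R) :
    (t.card : ℝ) * ρ ^ d ≤ d * (R - r + 2 * ρ) * (R + ρ) ^ (d - 1) := by
  have : Nonempty (Fin d) := ⟨⟨0, hd⟩⟩
  set V : Measure (EuclideanSpace ℝ (Fin d)) := volume
  have hball : ∀ (x : EuclideanSpace ℝ (Fin d)) (s : ℝ), 0 ≤ s →
      V.real (Metric.ball x s) = s ^ d * V.real (Metric.ball 0 1) := by
    intro x s hs
    simp [Measure.real, V, Measure.addHaar_ball _ x hs, ENNReal.toReal_mul, hs]
  have hVpos : 0 < V.real (Metric.ball 0 1) :=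
    ENNReal.toReal_pos (Metric.measure_ball_pos _ _ one_pos).ne' measure_ball_lt_top.ne
  have hcb : V.real (Metric.closedBall 0 (R + ρ)) = (R + ρ) ^ d * V.real (Metric.ball 0 1) := by
    simp [Measure.real, V, Measure.addHaar_closedBall _ (0 : EuclideanSpace ℝ (Fin d))
      (show 0 ≤ R + ρ by linarith), ENNReal.toReal_mul, (show 0 ≤ R + ρ by linarith)]
  have hU : V.real (⋃ x ∈ t, Metric.ball x ρ) = t.card * (ρ ^ d * V.real (Metric.ball 0 1)) := by
    rw [measureReal_biUnion_finset]
    · simp [hball _ ρ hρ.le]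
    · intro i hi j hj hij
      apply Metric.ball_disjoint_ball
      rw [dist_eq_norm]
      linarith [hdisc i hi j hj hij]
    · exact fun _ _ => Metric.isOpen_ball.measurableSet
  have hsub : (⋃ x ∈ t, Metric.ball x ρ) ∪ Metric.ball 0 (r - ρ) ⊆
      Metric.closedBall 0 (R + ρ) := by
    intro y hy
    simp only [mem_union, mem_iUnion, Metric.mem_ball, dist_eq_norm, sub_zero,
      Metric.mem_closedBall] at hy ⊢
    rcases hy with ⟨x, hx, hxy⟩ | hy
    · have := (ht x hx).2
      have := norm_le_norm_add_norm_sub x y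
      rw [norm_sub_rev] at this
      linarith
    · linarith
  have hdj : Disjoint (⋃ x ∈ t, Metric.ball x ρ) (Metric.ball 0 (r - ρ)) := by
    rw [Set.disjoint_left]
    intro y hy hy'
    simp only [mem_iUnion, Metric.mem_ball, dist_eq_norm, sub_zero] at hy hy'
    obtain ⟨x, hx, hxy⟩ := hy
    have := (ht x hx).1
    have := norm_le_norm_add_norm_sub y x
    linarith
  have hle : V.real ((⋃ x ∈ t, Metric.ball x ρ) ∪ Metric.ball 0 (r - ρ)) ≤
      V.real (Metric.closedBall 0 (R + ρ)) :=
    measureReal_mono hsub measure_closedBall_lt_top.ne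
  rw [measureReal_union hdj Metric.isOpen_ball.measurableSet
    (ne_top_of_le_ne_top measure_closedBall_lt_top.ne
      (measure_mono (subset_union_left.trans hsub))) measure_ball_lt_top.ne,
    hU, hcb, hball 0 (r - ρ) (by linarith)] at hle
  have h1 : (t.card : ℝ) * ρ ^ d ≤ (R + ρ) ^ d - (r - ρ) ^ d := by
    by_contra! h
    nlinarith
  have h2 : (R + ρ) ^ d - (r - ρ) ^ d ≤ d * (R - r + 2 * ρ) * (R + ρ) ^ (d - 1) := by
    have h := abs_pow_sub_pow_le (R + ρ) (r - ρ) d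
    have h0 := le_abs_self ((R + ρ) ^ d - (r - ρ) ^ d)
    rw [abs_of_nonneg (show 0 ≤ R + ρ - (r - ρ) by linarith),
      abs_of_nonneg (show 0 ≤ R + ρ by linarith), abs_of_nonneg (show 0 ≤ r - ρ by linarith),
      max_eq_left (by linarith)] at h
    calc _ ≤ _ := h0.trans h
      _ = _ := by ring
  exact h1.trans h2

lemma aux_exp {p : ℝ} (h0 : 0 ≤ p) (h1 : p ≤ 1 / 2) : Real.exp (-(2 * p)) ≤ 1 - p := by
  rw [Real.exp_neg]
  have h : 1 + 2 * p ≤ Real.exp (2 * p) := by linarith [Real.add_one_le_exp (2 * p)]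
  calc (Real.exp (2 * p))⁻¹ ≤ (1 + 2 * p)⁻¹ := by gcongr
    _ ≤ 1 - p := by
      rw [inv_le_iff_one_le_mul₀ (by linarith)]
      nlinarith

lemma aux_q (ν : Measure ℝ) [IsProbabilityMeasure ν] (h : ν (Icc (0 : ℝ) 1) = 1) (ε : ℝ) :
    1 - ν.real (Icc ε 1) ≤ ν.real (Iic ε) := by
  have h1 : ν.real (Icc (0 : ℝ) 1) = 1 := by simp [Measure.real, h]
  have h2 : ν.real (Icc (0 : ℝ) 1) ≤ ν.real (Iic ε ∪ Icc ε 1) := by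
    refine measureReal_mono ?_ (measure_ne_top _ _)
    intro x hx
    rcases le_total x ε with h | h
    · exact Or.inl h
    · exact Or.inr ⟨h, hx.2⟩
  have h3 := measureReal_union_le (μ := ν) (Iic ε) (Icc ε 1)
  linarith

lemma aux_ann {d : ℕ} (hd : 1 ≤ d) (S : Set (EuclideanSpace ℝ (Fin d)))
    (ρ : ℝ) (hρ : 0 < ρ)
    (hdisc : ∀ i ∈ S, ∀ j ∈ S, i ≠ j → 2 * ρ ≤ ‖i - j‖)
    (μ : S → Measure ℝ) (hprob : ∀ i, IsProbabilityMeasure (μ i))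
    (hsupp : ∀ i, μ i (Icc (0 : ℝ) 1) = 1) (ε δ M r m : ℝ) (hδ0 : 0 < δ) (hδ : δ ≤ 1 / 2)
    (hM : ∀ i : S, M ≤ ‖(i : EuclideanSpace ℝ (Fin d))‖ →
      ‖(i : EuclideanSpace ℝ (Fin d))‖ ^ (d - 1) * (μ i).real (Icc ε 1) ≤ δ)
    (hMr : M ≤ r) (hr1 : 1 ≤ r) (hmr : m + ρ ≤ r) (hm : 2 * ρ ≤ m) :
    ∃ t : Finset S, (∀ i : S, i ∈ t ↔ (i : EuclideanSpace ℝ (Fin d)) ∈ annulus d r (r + m)) ∧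
      Real.exp (-((d * 4 * 2 ^ (d - 1) / ρ ^ d) * δ * m)) ≤ ∏ i ∈ t, (μ i).real (Iic ε) := by
  have hcount : ∀ t : Finset S, (∀ i ∈ t, (i : EuclideanSpace ℝ (Fin d)) ∈ annulus d r (r + m)) →
      (t.card : ℝ) * ρ ^ d ≤ d * (2 * m) * (2 * r) ^ (d - 1) := by
    intro t ht
    have h := aux_count hd (t.map (Function.Embedding.subtype _)) ρ r (r + m) hρ
      (by linarith) (by linarith) (by
        intro i hi j hj
        simp only [Finset.mem_map, Function.Embedding.subtype_apply] at hi hj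
        obtain ⟨i, _, rfl⟩ := hi
        obtain ⟨j, _, rfl⟩ := hj
        exact hdisc _ i.2 _ j.2) (by
        intro i hi
        simp only [Finset.mem_map, Function.Embedding.subtype_apply] at hi
        obtain ⟨i, hi, rfl⟩ := hi
        exact ht i hi)
    rw [Finset.card_map] at h
    refine h.trans ?_
    have h1 : 0 ≤ r + m + ρ := by linarith
    have h2 : r + m + ρ ≤ 2 * r := by linarith
    have h3 : r + m - r + 2 * ρ ≤ 2 * m := by linarith
    have h4 : 0 ≤ m := by linarith
    gcongr
  have hρd : 0 < ρ ^ d := by positivity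
  have hfin : {i : S | (i : EuclideanSpace ℝ (Fin d)) ∈ annulus d r (r + m)}.Finite := by
    by_contra hinf
    obtain ⟨N, hN⟩ := exists_nat_gt ((d * (2 * m) * (2 * r) ^ (d - 1)) / ρ ^ d)
    obtain ⟨t, hts, htc⟩ := Set.Infinite.exists_subset_card_eq hinf N
    have h := hcount t (fun i hi => hts hi)
    rw [div_lt_iff₀ hρd, ← htc] at hN
    linarith
  refine ⟨hfin.toFinset, fun i => by simp, ?_⟩
  set t := hfin.toFinset with ht
  have htm : ∀ i ∈ t, (i : EuclideanSpace ℝ (Fin d)) ∈ annulus d r (r + m) := by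
    intro i hi; simpa [ht] using hi
  have hrd : 0 < r ^ (d - 1) := by positivity
  have hp : ∀ i ∈ t, (μ i).real (Icc ε 1) ≤ δ / r ^ (d - 1) := by
    intro i hi
    rw [le_div_iff₀ hrd]
    have h1 := (htm i hi).1
    have h2 := hM i (hMr.trans h1)
    have h3 : r ^ (d - 1) ≤ ‖(i : EuclideanSpace ℝ (Fin d))‖ ^ (d - 1) := by gcongr
    have h4 : 0 ≤ (μ i).real (Icc ε 1) := measureReal_nonneg
    nlinarith
  have hp2 : δ / r ^ (d - 1) ≤ 1 / 2 := by
    refine le_trans ?_ hδ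
    exact div_le_self hδ0.le (one_le_pow₀ hr1)
  have hq : ∀ i ∈ t, Real.exp (-(2 * (δ / r ^ (d - 1)))) ≤ (μ i).real (Iic ε) := by
    intro i hi
    have := hprob i
    calc _ ≤ 1 - δ / r ^ (d - 1) := aux_exp (by positivity) hp2
      _ ≤ 1 - (μ i).real (Icc ε 1) := by linarith [hp i hi]
      _ ≤ _ := aux_q _ (hsupp i) ε
  calc Real.exp (-((d * 4 * 2 ^ (d - 1) / ρ ^ d) * δ * m))
      ≤ Real.exp (-(2 * (δ / r ^ (d - 1)))) ^ t.card := by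
        rw [← Real.exp_nat_mul]
        apply Real.exp_le_exp.2
        rw [mul_neg, neg_le_neg_iff]
        have h := hcount t htm
        rw [← le_div_iff₀ hρd] at h
        calc (t.card : ℝ) * (2 * (δ / r ^ (d - 1)))
            ≤ (d * (2 * m) * (2 * r) ^ (d - 1) / ρ ^ d) * (2 * (δ / r ^ (d - 1))) := by gcongr
          _ = _ := by rw [mul_pow]; field_simp; ring
    _ = ∏ i ∈ t, Real.exp (-(2 * (δ / r ^ (d - 1)))) := by simp
    _ ≤ _ := Finset.prod_le_prod (fun _ _ => (Real.exp_pos _).le) hq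

lemma aux_tail (a : ℝ) (ha : 1 < a) (M ρ : ℝ) : ∀ᶠ n : ℕ in Filter.atTop,
    M ≤ a ^ (n + 1) ∧ (n : ℝ) + 1 + ρ ≤ a ^ (n + 1) ∧ 2 * ρ ≤ (n : ℝ) + 1 ∧
    ((n : ℝ) + 1) * ((n : ℝ) + 2) ≤ (a - 1) * (Real.sqrt a) ^ (n + 1) := by
  have hb : 1 < Real.sqrt a := by
    rw [Real.lt_sqrt (by norm_num)]; simpa using ha
  have hs : Filter.Tendsto (fun n : ℕ => n + 1) Filter.atTop Filter.atTop :=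
    Filter.tendsto_add_atTop_nat 1
  have h1 := ((tendsto_pow_atTop_atTop_of_one_lt ha).comp hs).eventually_ge_atTop M
  have h3 := (tendsto_natCast_atTop_atTop (R := ℝ)).eventually_ge_atTop (2 * ρ)
  have h3' := (tendsto_natCast_atTop_atTop (R := ℝ)).eventually_ge_atTop ρ
  have h2 := ((tendsto_pow_const_div_const_pow_of_one_lt 1 ha).comp hs).eventually_le_const
    (show (0 : ℝ) < 1 / 2 by norm_num)
  have h4 := ((tendsto_pow_const_div_const_pow_of_one_lt 2 hb).comp hs).eventually_le_const
    (show (0 : ℝ) < (a - 1) / 2 by linarith)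
  filter_upwards [h1, h2, h3, h3', h4] with n h1 h2 h3 h3' h4
  simp only [Function.comp, Nat.cast_add, Nat.cast_one] at h1 h2 h4
  rw [div_le_iff₀ (by positivity)] at h2 h4
  have : (0 : ℝ) ≤ n := Nat.cast_nonneg n
  refine ⟨h1, by linarith, by linarith, by nlinarith⟩

theorem stmt0 (d : ℕ) (hd : 1 ≤ d) (S : Set (EuclideanSpace ℝ (Fin d)))
    (rSigma : ℝ) (hrSigma : 0 < rSigma)
    (hdisc : ∀ i ∈ S, ∀ j ∈ S, i ≠ j → rSigma ≤ ‖i - j‖)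
    (μ : S → Measure ℝ) (hprob : ∀ i, IsProbabilityMeasure (μ i))
    (hsupp : ∀ i, μ i (Icc (0 : ℝ) 1) = 1)
    (P : Measure (S → ℝ)) (hPprob : IsProbabilityMeasure P)
    (hprod : ∀ (t : Finset S) (s : S → Set ℝ), (∀ i, MeasurableSet (s i)) →
      P {ω | ∀ i ∈ t, ω i ∈ s i} = ∏ i ∈ t, μ i (s i))
    (ε : ℝ) (hε : 0 < ε) (a : ℝ) (ha : 1 < a)
    (hdecay : Filter.Tendsto
      (fun i : S => ‖(i : EuclideanSpace ℝ (Fin d))‖ ^ (d - 1) * (μ i (Icc ε 1)).toReal)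
      (Filter.comap (fun i : S => ‖(i : EuclideanSpace ℝ (Fin d))‖) Filter.atTop)
      (nhds 0)) :
    ∑' n : ℕ,
        P {ω | ¬ ∃ r ∈ Icc (a ^ (n + 1)) (a ^ (n + 2) - ((n : ℝ) + 1)),
          epsFree S ε ω (annulus d r (r + ((n : ℝ) + 1)))} < ⊤ := by
  classical
  obtain ⟨ρ, hρdef⟩ : ∃ ρ, ρ = rSigma / 2 := ⟨_, rfl⟩
  have hρ : 0 < ρ := by linarith
  have hdisc' : ∀ i ∈ S, ∀ j ∈ S, i ≠ j → 2 * ρ ≤ ‖i - j‖ := by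
    intro i hi j hj hij
    have := hdisc i hi j hj hij
    linarith
  obtain ⟨C, hC⟩ : ∃ C : ℝ, C = d * 4 * 2 ^ (d - 1) / ρ ^ d := ⟨_, rfl⟩
  have hd0 : (0 : ℝ) < d := by exact_mod_cast hd
  have hC0 : 0 < C := by rw [hC]; positivity
  have hla : 0 < Real.log a := Real.log_pos ha
  obtain ⟨δ, hδ0, hδ1, hδ2⟩ : ∃ δ : ℝ, 0 < δ ∧ δ ≤ 1 / 2 ∧ C * δ ≤ Real.log a / 2 := by
    refine ⟨min (1 / 2) (Real.log a / 2 / C), by positivity, min_le_left _ _, ?_⟩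
    rw [← le_div_iff₀' hC0]
    exact min_le_right _ _
  obtain ⟨M, hM⟩ : ∃ M : ℝ, ∀ i : S, M ≤ ‖(i : EuclideanSpace ℝ (Fin d))‖ →
      ‖(i : EuclideanSpace ℝ (Fin d))‖ ^ (d - 1) * (μ i).real (Icc ε 1) ≤ δ := by
    have h := hdecay.eventually_le_const hδ0
    rw [Filter.eventually_comap] at h
    obtain ⟨M, hM⟩ := Filter.eventually_atTop.1 h
    exact ⟨M, fun i hi => hM _ hi i rfl⟩
  obtain ⟨b, hbdef⟩ : ∃ b, b = Real.sqrt a := ⟨_, rfl⟩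
  have hb : 1 < b := by
    rw [hbdef, Real.lt_sqrt (by norm_num)]; simpa using ha
  have hb2 : b * b = a := by rw [hbdef]; exact Real.mul_self_sqrt (by linarith)
  have hsum : Summable (fun n : ℕ =>
      P.real {ω | ¬ ∃ r ∈ Icc (a ^ (n + 1)) (a ^ (n + 2) - ((n : ℝ) + 1)),
          epsFree S ε ω (annulus d r (r + ((n : ℝ) + 1)))}) := by
    have hg : Summable (fun n : ℕ => Real.exp (-(n : ℝ))) := Real.summable_exp_neg_nat
    refine Summable.of_norm_bounded_eventually_nat hg ?_
    filter_upwards [aux_tail a ha M ρ] with n hn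
    obtain ⟨hn1, hn2, hn3, hn4⟩ := hn
    rw [Real.norm_of_nonneg measureReal_nonneg]
    obtain ⟨m, hm⟩ : ∃ m : ℝ, m = (n : ℝ) + 1 := ⟨_, rfl⟩
    rw [← hm] at hn2 hn3 hn4 ⊢
    have hm0 : 1 ≤ m := by rw [hm]; linarith [(Nat.cast_nonneg n : (0 : ℝ) ≤ n)]
    have hpa : 1 ≤ a ^ (n + 1) := one_le_pow₀ ha.le
    have key : ∀ k : ℕ, ∃ t : Finset S, (∀ i : S, i ∈ t ↔ (i : EuclideanSpace ℝ (Fin d)) ∈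
        annulus d (a ^ (n + 1) + (m + 1) * k) (a ^ (n + 1) + (m + 1) * k + m)) ∧
        Real.exp (-(C * δ * m)) ≤ ∏ i ∈ t, (μ i).real (Iic ε) := by
      intro k
      have : 0 ≤ (m + 1) * k := by positivity
      rw [hC]
      exact aux_ann hd S ρ hρ hdisc' μ hprob hsupp ε δ M _ m hδ0 hδ1 hM
        (by linarith) (by linarith) (by linarith) hn3
    choose T hT hTq using key
    have hTd : ∀ k l, k ≠ l → Disjoint (T k) (T l) := by
      have hlt : ∀ k l, k < l → Disjoint (T k) (T l) := by
        intro k l hkl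
        rw [Finset.disjoint_left]
        intro i hik hil
        have h1 := ((hT k i).1 hik).2
        have h2 := ((hT l i).1 hil).1
        have h3 : (k : ℝ) + 1 ≤ l := by exact_mod_cast hkl
        nlinarith
      intro k l hkl
      rcases lt_or_gt_of_ne hkl with h | h
      · exact hlt k l h
      · exact (hlt l k h).symm
    obtain ⟨K, hK⟩ : ∃ K : ℕ, K = ⌊(a ^ (n + 2) - a ^ (n + 1)) / (m + 1)⌋₊ := ⟨_, rfl⟩
    have hnum : a ^ (n + 2) - a ^ (n + 1) = (a - 1) * a ^ (n + 1) := by ring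
    have hpos : 0 ≤ (a ^ (n + 2) - a ^ (n + 1)) / (m + 1) := by
      rw [hnum]
      have : 0 ≤ a - 1 := by linarith
      positivity
    have hK1 : (K : ℝ) * (m + 1) ≤ a ^ (n + 2) - a ^ (n + 1) := by
      rw [← le_div_iff₀ (by linarith), hK]
      exact Nat.floor_le hpos
    have hK2 : (a ^ (n + 2) - a ^ (n + 1)) ≤ (K + 1 : ℝ) * (m + 1) := by
      rw [← div_le_iff₀ (by linarith), hK]
      exact (Nat.lt_floor_add_one _).le
    have hind := aux_indep μ P hprod ε T hTd (Finset.range K) ∅ (by simp)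
    have hsub : {ω : S → ℝ | ¬ ∃ r ∈ Icc (a ^ (n + 1)) (a ^ (n + 2) - m),
          epsFree S ε ω (annulus d r (r + m))} ⊆
        {ω | (∀ i ∈ (∅ : Finset S), ω i ≤ ε) ∧
          ∀ k ∈ Finset.range K, ¬ ∀ i ∈ T k, ω i ≤ ε} := by
      intro ω hω
      refine ⟨by simp, fun k hk hall => hω ⟨a ^ (n + 1) + (m + 1) * k, ⟨?_, ?_⟩, ?_⟩⟩
      · have : 0 ≤ (m + 1) * k := by positivity
        linarith
      · have h3 : (k : ℝ) + 1 ≤ K := by exact_mod_cast Finset.mem_range.1 hk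
        nlinarith
      · intro i hi
        exact hall i ((hT k i).2 hi)
    have hbm : 0 < b ^ (n + 1) := by positivity
    have hx : (b ^ (n + 1))⁻¹ ≤ Real.exp (-(C * δ * m)) := by
      have h1 : b ^ (n + 1) = Real.exp (m * (Real.log a / 2)) := by
        have : Real.log b = Real.log a / 2 := by
          rw [← hb2, Real.log_mul (by linarith) (by linarith)]; ring
        rw [← this, hm]
        have : Real.exp (Real.log b) = b := Real.exp_log (by linarith)
        have h5 := Real.exp_nat_mul (Real.log b) (n + 1)
        rw [this] at h5
        rw [← h5]; push_cast; rfl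
      rw [h1, ← Real.exp_neg]
      apply Real.exp_le_exp.2
      nlinarith
    have hq1 : ∀ k, ∏ i ∈ T k, (μ i).real (Iic ε) ≤ 1 := by
      intro k
      refine Finset.prod_le_one (fun _ _ => measureReal_nonneg) (fun i _ => ?_)
      have := hprob i
      exact measureReal_le_one
    calc P.real _ ≤ _ := measureReal_mono hsub (measure_ne_top _ _)
      _ = ∏ k ∈ Finset.range K, (1 - ∏ i ∈ T k, (μ i).real (Iic ε)) := by rw [hind]; simp
      _ ≤ ∏ k ∈ Finset.range K, Real.exp (-(b ^ (n + 1))⁻¹) := by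
        refine Finset.prod_le_prod (fun k _ => by linarith [hq1 k]) (fun k _ => ?_)
        have h1 := Real.add_one_le_exp (-(b ^ (n + 1))⁻¹)
        linarith [hTq k]
      _ = Real.exp (K * (-(b ^ (n + 1))⁻¹)) := by rw [Real.exp_nat_mul]; simp
      _ ≤ Real.exp (-(n : ℝ)) := by
        apply Real.exp_le_exp.2
        rw [mul_neg, neg_le_neg_iff, ← div_eq_mul_inv, le_div_iff₀ hbm]
        have hab : a ^ (n + 1) = b ^ (n + 1) * b ^ (n + 1) := by rw [← mul_pow, hb2]
        have hb1 : 1 ≤ b ^ (n + 1) := one_le_pow₀ hb.le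
        have hn4' : m * (m + 1) ≤ (a - 1) * b ^ (n + 1) := by
          rw [hbdef]
          calc m * (m + 1) = m * ((n : ℝ) + 2) := by rw [hm]; ring
            _ ≤ _ := hn4
        rw [hnum, hab] at hK2
        have h6 : m * b ^ (n + 1) * (m + 1) ≤ (K + 1 : ℝ) * (m + 1) := by nlinarith
        have h7 : m * b ^ (n + 1) ≤ K + 1 := le_of_mul_le_mul_right h6 (by linarith)
        have : (n : ℝ) = m - 1 := by linarith
        rw [this]
        linarith
  have h := hsum.tsum_ofReal_ne_top
  refine lt_top_iff_ne_top.2 (ne_of_eq_of_ne ?_ h)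
  exact tsum_congr (fun n => (ENNReal.ofReal_toReal (measure_ne_top _ _)).symm)
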